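/- arXiv:2303.00527 — 4 statements merged into one kernel-verified Lean document; each statement's English description precedes it below -/
import Mathlib

section
/- Let G=(V,E) be a finite directed multigraph with nonnegative link delays d and costs c, s≠t vertices, L ≤ U and M real numbers. Let P be an elementary path from s to t with L ≤ d(P) ≤ U and c(P) < M. Then for every decomposition P = P₁ ++ P₂ where the prefix P₁ ends at a vertex u (and P₂ is a path from u to t): d(P₁) + minDelay(u,t) ≤ U and c(P₁) + minCost(u,t) < M, where minDelay(u,t) (resp. minCost(u,t)) is the minimum of d(Q) (resp. c(Q)) over all elementary paths Q from u to t. In other words, neither of the Pulse+ pruning conditions 'd(P₁)+minDelay(u,t) > U' nor 'c(P₁)+minCost(u,t) ≥ M' holds at any prefix of a feasible path of cost below M. -/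
/-- `IsPath src dst s t P` : `P` is a nonempty finite sequence of links forming a
path from `s` to `t` in the directed multigraph with source map `src` and
target map `dst`. -/
inductive IsPath {V E : Type} (src dst : E → V) : V → V → List E → Prop
  | single (e : E) : IsPath src dst (src e) (dst e) [e]
  | cons (e : E) {t : V} {l : List E} :
      IsPath src dst (dst e) t l → IsPath src dst (src e) t (e :: l)

/-- A path starting at `s` is elementary if it visits no vertex twice. -/
def Elementary {V E : Type} (dst : E → V) (s : V) (P : List E) : Prop :=
  (s :: P.map dst).Nodup

/-- The delay of a path: sum of the link delays. -/
def pathDelay {E : Type} (d : E → ℝ) (P : List E) : ℝ := (P.map d).sum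

/-- The cost of a path: sum of the link costs. -/
def pathCost {E : Type} (c : E → ℝ) (P : List E) : ℝ := (P.map c).sum

theorem IsPath.target_mem_map {V E : Type} {src dst : E → V} {s u : V} {P : List E}
    (h : IsPath src dst s u P) : u ∈ P.map dst := by
  induction h with
  | single e => simp
  | cons e _ ih => exact List.mem_cons_of_mem _ ih

theorem Elementary.of_append {V E : Type} {src dst : E → V} {s u : V} {P₁ P₂ : List E}
    (h : Elementary dst s (P₁ ++ P₂)) (hP₁ : IsPath src dst s u P₁) :
    Elementary dst u P₂ := by
  unfold Elementary at h ⊢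
  rw [List.map_append, List.nodup_cons, List.nodup_append] at h
  obtain ⟨-, -, h₂, hdisj⟩ := h
  exact List.nodup_cons.2 ⟨fun hu => hdisj u hP₁.target_mem_map u hu rfl, h₂⟩

theorem sInf_elementary_weight_le {V E : Type} {src dst : E → V} {w : E → ℝ}
    (hw : ∀ e, 0 ≤ w e) {u t : V} {Q : List E}
    (hQ : IsPath src dst u t Q) (hQe : Elementary dst u Q) :
    sInf {x | ∃ Q, IsPath src dst u t Q ∧ Elementary dst u Q ∧ x = (Q.map w).sum} ≤
      (Q.map w).sum := by
  refine csInf_le ⟨0, ?_⟩ ⟨Q, hQ, hQe, rfl⟩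
  rintro x ⟨R, -, -, rfl⟩
  exact List.sum_nonneg (by simpa using fun e _ => hw e)

/-- no prefix of an elementary feasible path of cost below `M`
is cut by either of the two Pulse+ pruning tests. -/
theorem pulse_plus_prefix_survives {V E : Type} [Fintype V] [Fintype E]
    (src dst : E → V) (d c : E → ℝ)
    (hd : ∀ e, 0 ≤ d e) (hc : ∀ e, 0 ≤ c e)
    (s t : V) (hst : s ≠ t) (L U M : ℝ) (hLU : L ≤ U)
    (P : List E) (hP : IsPath src dst s t P) (hPe : Elementary dst s P)
    (hL : L ≤ pathDelay d P) (hU : pathDelay d P ≤ U)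
    (hM : pathCost c P < M)
    (P₁ P₂ : List E) (u : V) (hsplit : P = P₁ ++ P₂)
    (hP₁ : IsPath src dst s u P₁) (hP₂ : IsPath src dst u t P₂) :
    pathDelay d P₁ +
      sInf {x | ∃ Q, IsPath src dst u t Q ∧ Elementary dst u Q ∧ x = pathDelay d Q} ≤ U ∧
    pathCost c P₁ +
      sInf {x | ∃ Q, IsPath src dst u t Q ∧ Elementary dst u Q ∧ x = pathCost c Q} < M := by
  subst hsplit
  have hP₂e := hPe.of_append hP₁
  have hdelay := sInf_elementary_weight_le hd hP₂ hP₂e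
  have hcost := sInf_elementary_weight_le hc hP₂ hP₂e
  simp only [pathDelay, pathCost, List.map_append, List.sum_append] at hU hM ⊢
  exact ⟨by linarith, by linarith⟩
end

section
/- Let G=(V,E) be a finite directed multigraph with nonnegative link delays d and costs c, let s, u, t be vertices, and let U, M be reals. Let P₁ be an elementary path from s to u, and let f: ℝ → ℝ ∪ {+∞} be a function such that for all l ∈ ℝ with l ≤ U − minDelay(s,u): (i) f(l) = +∞ whenever there exists no elementary path Q from u to t with d(Q) ≤ l, and (ii) f(l) ≤ c(Q) for every elementary path Q from u to t with d(Q) ≤ l. If c(P₁) + f(U − d(P₁)) ≥ M, then there is no elementary path Q from u to t with d(P₁) + d(Q) ≤ U and c(P₁) + c(Q) < M. -/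
theorem pathDelay_nonneg {E : Type} {d : E → ℝ} (hd : ∀ e, 0 ≤ d e) (P : List E) :
    0 ≤ pathDelay d P :=
  List.sum_nonneg (by simpa using fun e _ => hd e)

/-- joint-pruning soundness, Theorem 4: if
`c(P₁) + f(U − d(P₁)) ≥ M` for a valid cost function `f`, then extending the
branch `P₁` cannot yield an elementary path to `t` that is feasible for the
delay upper bound `U` with total cost below `M`. -/
theorem joint_pruning_sound {V E : Type} [Fintype V] [Fintype E]
    (src dst : E → V) (d c : E → ℝ)
    (hd : ∀ e, 0 ≤ d e) (hc : ∀ e, 0 ≤ c e)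
    (s u t : V) (U M : ℝ)
    (P₁ : List E) (hP₁ : IsPath src dst s u P₁) (hP₁e : Elementary dst s P₁)
    (f : ℝ → EReal)
    (hf₁ : ∀ l : ℝ,
      l ≤ U - sInf {x | ∃ Q, IsPath src dst s u Q ∧ Elementary dst s Q ∧ x = pathDelay d Q} →
      (¬ ∃ Q, IsPath src dst u t Q ∧ Elementary dst u Q ∧ pathDelay d Q ≤ l) →
      f l = ⊤)
    (hf₂ : ∀ l : ℝ,
      l ≤ U - sInf {x | ∃ Q, IsPath src dst s u Q ∧ Elementary dst s Q ∧ x = pathDelay d Q} →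
      ∀ Q, IsPath src dst u t Q → Elementary dst u Q → pathDelay d Q ≤ l →
      f l ≤ (pathCost c Q : EReal))
    (hprune : (M : EReal) ≤ (pathCost c P₁ : EReal) + f (U - pathDelay d P₁)) :
    ¬ ∃ Q, IsPath src dst u t Q ∧ Elementary dst u Q ∧
      pathDelay d P₁ + pathDelay d Q ≤ U ∧ pathCost c P₁ + pathCost c Q < M := by
  rintro ⟨Q, hQ, hQe, hdelay, hcost⟩
  have hmin : sInf {x | ∃ Q, IsPath src dst s u Q ∧ Elementary dst s Q ∧ x = pathDelay d Q}
      ≤ pathDelay d P₁ := by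
    refine csInf_le ⟨0, ?_⟩ ⟨P₁, hP₁, hP₁e, rfl⟩
    rintro _ ⟨R, -, -, rfl⟩
    exact pathDelay_nonneg hd R
  have hf : f (U - pathDelay d P₁) ≤ (pathCost c Q : EReal) :=
    hf₂ _ (by linarith) Q hQ hQe (by linarith)
  have hM : (M : EReal) ≤ ((pathCost c P₁ + pathCost c Q : ℝ) : EReal) := by
    rw [EReal.coe_add]
    exact hprune.trans (by gcongr)
  exact absurd (EReal.coe_le_coe_iff.mp hM) (not_le.mpr hcost)
end

section
/- Let G=(V,E) be a finite directed multigraph with nonnegative link delays d and costs c, and let u, t be vertices with at least one elementary path from u to t. Set Dmin = minDelay(u,t) and Cmin = minCost(u,t) (the minimum delay, respectively minimum cost, over elementary u-to-t paths), and define f(l) = +∞ for l < Dmin and f(l) = Cmin for l ≥ Dmin. Then: (a) f(l) = +∞ whenever there is no elementary path Q from u to t with d(Q) ≤ l, and f(l) ≤ c(Q) for every elementary path Q from u to t with d(Q) ≤ l; and (b) for any reals U, M and any path P₁ from s to u, the condition c(P₁) + f(U − d(P₁)) ≥ M holds if and only if d(P₁) + Dmin > U or c(P₁) + Cmin ≥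 M. -/
/-- the cost function of Equation (9) is a valid cost function,
and with it the joint pruning condition (8) degenerates to the original
Pulse+ pruning strategy (6). -/
theorem joint_pruning_degenerates {V E : Type} [Fintype V] [Fintype E]
    (src dst : E → V) (d c : E → ℝ)
    (hd : ∀ e, 0 ≤ d e) (hc : ∀ e, 0 ≤ c e)
    (u t : V) (Dmin Cmin : ℝ)
    (hD : IsLeast {x | ∃ Q, IsPath src dst u t Q ∧ Elementary dst u Q ∧ x = pathDelay d Q} Dmin)
    (hC : IsLeast {x | ∃ Q, IsPath src dst u t Q ∧ Elementary dst u Q ∧ x = pathCost c Q} Cmin)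
    (f : ℝ → EReal)
    (hf : ∀ l : ℝ, f l = if l < Dmin then (⊤ : EReal) else (Cmin : EReal)) :
    ((∀ l : ℝ,
        (¬ ∃ Q, IsPath src dst u t Q ∧ Elementary dst u Q ∧ pathDelay d Q ≤ l) →
        f l = ⊤) ∧
      (∀ l : ℝ, ∀ Q, IsPath src dst u t Q → Elementary dst u Q → pathDelay d Q ≤ l →
        f l ≤ (pathCost c Q : EReal))) ∧
    (∀ (s : V) (U M : ℝ) (P₁ : List E), IsPath src dst s u P₁ →
      ((M : EReal) ≤ (pathCost c P₁ : EReal) + f (U - pathDelay d P₁) ↔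
        (U < pathDelay d P₁ + Dmin ∨ M ≤ pathCost c P₁ + Cmin))) := by
  refine ⟨⟨fun l hl => ?_, fun l Q hQ hE hQl => ?_⟩, fun s U M P₁ _ => ?_⟩
  · obtain ⟨Q, hQ, hE, hDQ⟩ := hD.1
    rw [hf, if_pos]
    by_contra! hlt
    exact hl ⟨Q, hQ, hE, hDQ ▸ hlt⟩
  · have hDQ : Dmin ≤ pathDelay d Q := hD.2 ⟨Q, hQ, hE, rfl⟩
    rw [hf, if_neg (hDQ.trans hQl).not_gt]
    exact EReal.coe_le_coe_iff.2 (hC.2 ⟨Q, hQ, hE, rfl⟩)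
  · rw [hf]
    split_ifs with hlt
    · rw [EReal.coe_add_top]
      exact ⟨fun _ => Or.inl (by linarith), fun _ => le_top⟩
    · rw [← EReal.coe_add, EReal.coe_le_coe_iff]
      exact ⟨Or.inr, fun h => h.resolve_left (by linarith)⟩
end

section
/- Let G=(V,E) be a finite directed multigraph with nonnegative link delays d and costs c, s ≠ t vertices, and U ≥ 0, and suppose there exists an elementary path P from s to t in G with d(P) ≤ U. Form G' from G by adding one new link e' from s to t with 0 ≤ d(e') ≤ U and c(e') > Σ_{e∈E} c(e), and equip G' with the Srlg structure in which every link belongs to exactly one Srlg, these Srlgs being distinct singletons. Consider the Srlg-disjoint DRCR problem on G' with delay upper bound U and delay diff δ = U: find two elementary s–t paths P_a, P_b with d(P_a) ≤ U, d(P_a) − δ ≤ d(P_b) ≤ min{U, d(P_a)+δ}, and Ω(P_a) ∩ Ω(P_b) = ∅, minimizing c(P_a). Then this Srlg-disjoint DRCR instance is feasible, and its optimal active-path cost equals min{ c(P) : P an elementary path from s to t in G with d(P) ≤ U }, i.e., the optimal value of the Delay Constrained Routing problem on G. -/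
theorem isPath_cons_iff {V E : Type} {src dst : E → V} {s t : V} {e : E} {l : List E} :
    IsPath src dst s t (e :: l) ↔
      src e = s ∧ (l = [] ∧ dst e = t ∨ IsPath src dst (dst e) t l) := by
  constructor
  · rintro (_ | ⟨_, h⟩)
    · exact ⟨rfl, Or.inl ⟨rfl, rfl⟩⟩
    · exact ⟨rfl, Or.inr h⟩
  · rintro ⟨rfl, ⟨rfl, rfl⟩ | h⟩
    · exact .single e
    · exact .cons e h

theorem not_isPath_nil {V E : Type} {src dst : E → V} {s t : V} :
    ¬ IsPath src dst s t [] := nofun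

theorem isPath_map_iff {V E F : Type} {src dst : F → V} (f : E → F) {s t : V} {P : List E} :
    IsPath src dst s t (P.map f) ↔ IsPath (src ∘ f) (dst ∘ f) s t P := by
  induction P generalizing s with
  | nil => simp [not_isPath_nil]
  | cons e l ih => simp [isPath_cons_iff, ih]

theorem elementary_map_iff {V E F : Type} {dst : F → V} (f : E → F) {s : V} {P : List E} :
    Elementary dst s (P.map f) ↔ Elementary (dst ∘ f) s P := by
  simp [Elementary]

theorem Elementary.nodup {V E : Type} {dst : E → V} {s : V} {P : List E}
    (h : Elementary dst s P) : P.Nodup :=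
  (List.nodup_cons.1 h).2.of_map dst

theorem pathCost_map {E F : Type} (c : F → ℝ) (f : E → F) (P : List E) :
    pathCost c (P.map f) = pathCost (c ∘ f) P := by
  simp [pathCost]

theorem pathDelay_map {E F : Type} (d : F → ℝ) (f : E → F) (P : List E) :
    pathDelay d (P.map f) = pathDelay (d ∘ f) P := by
  simp [pathDelay]

theorem le_pathCost_of_mem {E : Type} {c : E → ℝ} (hc : ∀ e, 0 ≤ c e) {P : List E} {e : E}
    (he : e ∈ P) : c e ≤ pathCost c P :=
  List.single_le_sum (by simpa using fun e _ => hc e) _ (List.mem_map_of_mem he)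

theorem pathCost_le_sum {E : Type} [Fintype E] {c : E → ℝ} (hc : ∀ e, 0 ≤ c e) {P : List E}
    (hP : P.Nodup) : pathCost c P ≤ ∑ e, c e := by
  classical
  rw [pathCost, ← List.sum_toFinset c hP]
  exact Finset.sum_le_univ_sum_of_nonneg hc

theorem finite_setOf_nodup (E : Type) [Finite E] : {P : List E | P.Nodup}.Finite := by
  have := Fintype.ofFinite E
  exact (List.finite_length_le E (Fintype.card E)).subset fun P hP => hP.length_le_card

theorem exists_map_some_of_none_notMem {E : Type} {P : List (Option E)} (h : none ∉ P) :
    ∃ Q : List E, Q.map some = P := by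
  have : P ∈ Set.range (List.map (some : E → Option E)) := by
    rw [Set.range_list_map]
    intro x hx
    cases x with
    | none => exact absurd hx h
    | some e => exact ⟨e, rfl⟩
  exact this

/-- reduction of Delay Constrained Routing to Srlg-disjoint DRCR.
`G'` is obtained from `G` by adding one new link (`none`) from `s` to `t` with
delay in `[0,U]` and cost exceeding the total cost of all links of `G`; every
link of `G'` forms its own singleton Srlg.  With delay diff `δ = U`, the
Srlg-disjoint DRCR instance on `G'` is feasible and its optimal active-path
cost equals the optimal value of DCR on `G`. -/
theorem dcr_reduces_to_srlg_drcr {V E : Type} [Fintype V] [Fintype E]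
    (src dst : E → V) (d c : E → ℝ)
    (hd : ∀ e, 0 ≤ d e) (hc : ∀ e, 0 ≤ c e)
    (s t : V) (hst : s ≠ t) (U : ℝ) (hU : 0 ≤ U)
    (hfeas : ∃ P, IsPath src dst s t P ∧ Elementary dst s P ∧ pathDelay d P ≤ U)
    (de ce : ℝ) (hde0 : 0 ≤ de) (hdeU : de ≤ U) (hce : ∑ e : E, c e < ce)
    (src' dst' : Option E → V) (d' c' : Option E → ℝ)
    (hsrc' : ∀ e : E, src' (some e) = src e) (hdst' : ∀ e : E, dst' (some e) = dst e)
    (hsrcn : src' none = s) (hdstn : dst' none = t)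
    (hd' : ∀ e : E, d' (some e) = d e) (hc' : ∀ e : E, c' (some e) = c e)
    (hdn : d' none = de) (hcn : c' none = ce)
    (Omega : Option E → Set (Option E)) (hOmega : ∀ e, Omega e = {e}) :
    (∃ Pa Pb : List (Option E),
      IsPath src' dst' s t Pa ∧ Elementary dst' s Pa ∧
      IsPath src' dst' s t Pb ∧ Elementary dst' s Pb ∧
      pathDelay d' Pa ≤ U ∧
      pathDelay d' Pa - U ≤ pathDelay d' Pb ∧
      pathDelay d' Pb ≤ min U (pathDelay d' Pa + U) ∧
      (⋃ e ∈ Pa, Omega e) ∩ (⋃ e ∈ Pb, Omega e) = ∅) ∧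
    (∃ m : ℝ,
      IsLeast {x : ℝ | ∃ Pa Pb : List (Option E),
        IsPath src' dst' s t Pa ∧ Elementary dst' s Pa ∧
        IsPath src' dst' s t Pb ∧ Elementary dst' s Pb ∧
        pathDelay d' Pa ≤ U ∧
        pathDelay d' Pa - U ≤ pathDelay d' Pb ∧
        pathDelay d' Pb ≤ min U (pathDelay d' Pa + U) ∧
        (⋃ e ∈ Pa, Omega e) ∩ (⋃ e ∈ Pb, Omega e) = ∅ ∧
        x = pathCost c' Pa} m ∧
      IsLeast {x : ℝ | ∃ P : List E,
        IsPath src dst s t P ∧ Elementary dst s P ∧ pathDelay d P ≤ U ∧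
        x = pathCost c P} m) := by
  obtain rfl : src' ∘ some = src := funext hsrc'
  obtain rfl : dst' ∘ some = dst := funext hdst'
  obtain rfl : d' ∘ some = d := funext hd'
  obtain rfl : c' ∘ some = c := funext hc'
  subst hsrcn hdstn hdn hcn
  have hc'nonneg : ∀ e, 0 ≤ c' e
    | none => (Finset.sum_nonneg fun e _ => hc e).trans hce.le
    | some e => hc e
  have pair {P : List E} (hP : IsPath (src' ∘ some) (dst' ∘ some) (src' none) (dst' none) P)
      (hel : Elementary (dst' ∘ some) (src' none) P) (hdel : pathDelay (d' ∘ some) P ≤ U) :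
      IsPath src' dst' (src' none) (dst' none) (P.map some) ∧
      Elementary dst' (src' none) (P.map some) ∧
      IsPath src' dst' (src' none) (dst' none) [none] ∧
      Elementary dst' (src' none) [none] ∧
      pathDelay d' (P.map some) ≤ U ∧
      pathDelay d' (P.map some) - U ≤ pathDelay d' [none] ∧
      pathDelay d' [none] ≤ min U (pathDelay d' (P.map some) + U) ∧
      (⋃ e ∈ P.map some, Omega e) ∩ (⋃ e ∈ [none], Omega e) = ∅ := by
    have h0 := pathDelay_nonneg hd P
    have hn : pathDelay d' [none] = d' none := by simp [pathDelay]
    rw [hn, pathDelay_map]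
    refine ⟨(isPath_map_iff some).2 hP, (elementary_map_iff some).2 hel, .single none,
      by simpa [Elementary] using hst, hdel, by linarith, le_min hdeU (by linarith), ?_⟩
    ext x
    cases x <;> simp [hOmega]
  obtain ⟨P₀, hP₀, hel₀, hdel₀⟩ := hfeas
  obtain ⟨P, ⟨hP, hel, hdel⟩, hmin⟩ := Set.exists_min_image
    {P : List E | IsPath (src' ∘ some) (dst' ∘ some) (src' none) (dst' none) P ∧
      Elementary (dst' ∘ some) (src' none) P ∧ pathDelay (d' ∘ some) P ≤ U}
    (pathCost (c' ∘ some)) ((finite_setOf_nodup E).subset fun _ h => h.2.1.nodup)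
    ⟨P₀, hP₀, hel₀, hdel₀⟩
  refine ⟨⟨_, _, pair hP hel hdel⟩, pathCost (c' ∘ some) P, ⟨?_, ?_⟩, ⟨P, hP, hel, hdel, rfl⟩, ?_⟩
  · obtain ⟨h₁, h₂, h₃, h₄, h₅, h₆, h₇, h₈⟩ := pair hP hel hdel
    exact ⟨_, _, h₁, h₂, h₃, h₄, h₅, h₆, h₇, h₈, (pathCost_map c' some P).symm⟩
  · rintro _ ⟨Pa, _, hPa, hela, -, -, hdela, -, -, -, rfl⟩
    by_cases hmem : none ∈ Pa
    · exact (pathCost_le_sum hc hel.nodup).trans (hce.le.trans (le_pathCost_of_mem hc'nonneg hmem))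
    · obtain ⟨Q, rfl⟩ := exists_map_some_of_none_notMem hmem
      rw [pathCost_map]
      rw [pathDelay_map] at hdela
      exact hmin Q ⟨(isPath_map_iff some).1 hPa, (elementary_map_iff some).1 hela, hdela⟩
  · rintro _ ⟨Q, hQ, helQ, hdelQ, rfl⟩
    exact hmin Q ⟨hQ, helQ, hdelQ⟩
end
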